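/- Let μ be an even log-concave measure on ℝⁿ, and let 0 ≤ q ≤ p and t > 0 satisfy p + t ≤ 1. If μ satisfies the (p,q)-inequality for every pair of origin-symmetric convex bodies in ℝⁿ, then μ satisfies the (p+t, q+t)-inequality for every pair of origin-symmetric convex bodies in ℝⁿ. -/

import Mathlib

open MeasureTheory
open scoped RealInnerProductSpace ENNReal

noncomputable section

abbrev Euc (n : ℕ) : Type := EuclideanSpace ℝ (Fin n)

/-- A convex body: a compact convex set with nonempty interior. -/
def IsConvexBody {n : ℕ} (K : Set (Euc n)) : Prop :=
  IsCompact K ∧ Convex ℝ K ∧ (interior K).Nonempty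

/-- The support function `h_K(u) = sup_{y ∈ K} ⟨u, y⟩`. -/
def suppFn {n : ℕ} (K : Set (Euc n)) (u : Euc n) : ℝ :=
  sSup ((fun y => ⟪u, y⟫) '' K)

/-- `lpComb p lam K L` is the `L_p` combination `lam·K +_p (1−lam)·L`;
for `p = 0` it is the logarithmic combination. -/
def lpComb {n : ℕ} (p lam : ℝ) (K L : Set (Euc n)) : Set (Euc n) :=
  if p = 0 then
    {x | ∀ u : Euc n, ‖u‖ = 1 → ⟪x, u⟫ ≤ suppFn K u ^ lam * suppFn L u ^ (1 - lam)}
  else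
    {x | ∀ u : Euc n, ‖u‖ = 1 →
      ⟪x, u⟫ ≤ (lam * suppFn K u ^ p + (1 - lam) * suppFn L u ^ p) ^ (1 / p)}


/-- The `(p,q)`-inequality of Conjecture 1.2 for the measure `μ` and the pair `K, L`:
for `q = 0` the multiplicative form, for `q ≠ 0` the additive `q/n`-form. -/
def PQIneq {n : ℕ} (μ : Measure (Euc n)) (p q : ℝ) (K L : Set (Euc n)) : Prop :=
  ∀ lam ∈ Set.Icc (0:ℝ) 1,
    (q = 0 → μ K ^ lam * μ L ^ (1 - lam) ≤ μ (lpComb p lam K L)) ∧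
    (q ≠ 0 →
      ENNReal.ofReal lam * μ K ^ (q / (n : ℝ)) + ENNReal.ofReal (1 - lam) * μ L ^ (q / (n : ℝ))
        ≤ μ (lpComb p lam K L) ^ (q / (n : ℝ)))

/-- The `p`-mean of `x` and `y` with weights `lam` and `1 - lam` (geometric for `p = 0`). -/
def powMean (p lam x y : ℝ) : ℝ :=
  if p = 0 then x ^ lam * y ^ (1 - lam) else (lam * x ^ p + (1 - lam) * y ^ p) ^ (1 / p)

lemma div_one_sub_mul_tangent {a w m : ℝ} (ha : 0 ≤ a) (hw : 0 < 1 - a * w)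
    (hm : 0 < 1 - a * m) :
    m / (1 - a * m) + (w - m) / (1 - a * m) ^ 2 ≤ w / (1 - a * w) := by
  have h : w / (1 - a * w) - (m / (1 - a * m) + (w - m) / (1 - a * m) ^ 2) =
      a * (w - m) ^ 2 / ((1 - a * w) * (1 - a * m) ^ 2) := by
    have hw' := hw.ne'
    have hm' := hm.ne'
    rw [div_add_div _ _ hm' (pow_ne_zero 2 hm'), div_sub_div _ _ hw' (by positivity),
      div_eq_div_iff (by positivity) (by positivity)]
    ring
  have : 0 ≤ a * (w - m) ^ 2 / ((1 - a * w) * (1 - a * m) ^ 2) := by positivity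
  linarith

lemma one_sub_mul_rpow_pos {a y r : ℝ} (ha0 : 0 ≤ a) (ha1 : a < 1) (hy0 : 0 < y) (hy1 : y ≤ 1)
    (hr : 0 ≤ r) : 0 < 1 - a * y ^ r := by
  have h1 : y ^ r ≤ 1 := Real.rpow_le_one hy0.le hy1 hr
  have h0 : 0 ≤ y ^ r := by positivity
  nlinarith

lemma hasDerivAt_log_one_sub_mul_rpow {a y r : ℝ} (ha0 : 0 ≤ a) (ha1 : a < 1) (hy0 : 0 < y)
    (hy1 : y ≤ 1) (hr : 0 ≤ r) :
    HasDerivAt (fun y : ℝ => Real.log (1 - a * y ^ r))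
      (-(a * r / y) * (y ^ r / (1 - a * y ^ r))) y := by
  have hpos := one_sub_mul_rpow_pos ha0 ha1 hy0 hy1 hr
  have h := (((Real.hasDerivAt_rpow_const (p := r) (Or.inl hy0.ne')).const_mul a).const_sub 1).log
    hpos.ne'
  convert h using 1
  rw [Real.rpow_sub_one hy0.ne']
  field_simp

/-- A function on `[y, 1]` with nonpositive derivative that vanishes at `1` is nonnegative. -/
lemma nonneg_of_hasDerivAt_nonpos {D D' : ℝ → ℝ} {y : ℝ} (hy0 : 0 < y) (hy1 : y ≤ 1)
    (hD : ∀ z, 0 < z → z ≤ 1 → HasDerivAt D (D' z) z) (hD' : ∀ z, 0 < z → z ≤ 1 → D' z ≤ 0)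
    (h1 : D 1 = 0) : 0 ≤ D y := by
  have hanti : AntitoneOn D (Set.Icc y 1) := by
    refine antitoneOn_of_deriv_nonpos (convex_Icc y 1) ?_ ?_ ?_
    · intro z hz
      exact (hD z (hy0.trans_le hz.1) hz.2).continuousAt.continuousWithinAt
    · intro z hz
      rw [interior_Icc] at hz
      exact (hD z (hy0.trans hz.1) hz.2.le).differentiableAt.differentiableWithinAt
    · intro z hz
      rw [interior_Icc] at hz
      rw [(hD z (hy0.trans hz.1) hz.2.le).deriv]
      exact hD' z (hy0.trans hz.1) hz.2.le
  have := hanti (Set.left_mem_Icc.2 hy1) (Set.right_mem_Icc.2 hy1) hy1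
  linarith

lemma log_one_sub_mul_rpow_combination {a y p q t : ℝ} (ha0 : 0 ≤ a) (ha1 : a < 1) (hy0 : 0 < y)
    (hy1 : y ≤ 1) (hq : 0 < q) (hqp : q ≤ p) (ht : 0 < t) :
    0 ≤ (1 - q / p) * Real.log (1 - a * y ^ t)
      + q / p * (t / (p + t)) * Real.log (1 - a * y ^ (p + t))
      - t / (q + t) * Real.log (1 - a * y ^ (q + t))
      - (q / (q + t) - q / (p + t)) * Real.log (1 - a) := by
  have hp : 0 < p := hq.trans_le hqp
  refine nonneg_of_hasDerivAt_nonpos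
    (D := fun y => (1 - q / p) * Real.log (1 - a * y ^ t)
      + q / p * (t / (p + t)) * Real.log (1 - a * y ^ (p + t))
      - t / (q + t) * Real.log (1 - a * y ^ (q + t))
      - (q / (q + t) - q / (p + t)) * Real.log (1 - a))
    (D' := fun y => -(a * t / y) * ((1 - q / p) * (y ^ t / (1 - a * y ^ t))
      + q / p * (y ^ (p + t) / (1 - a * y ^ (p + t))) - y ^ (q + t) / (1 - a * y ^ (q + t))))
    hy0 hy1 ?_ ?_ ?_
  · intro z hz0 hz1
    have h1 := (hasDerivAt_log_one_sub_mul_rpow ha0 ha1 hz0 hz1 ht.le).const_mul (1 - q / p)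
    have h2 := (hasDerivAt_log_one_sub_mul_rpow ha0 ha1 hz0 hz1
      (by positivity : 0 ≤ p + t)).const_mul (q / p * (t / (p + t)))
    have h3 := (hasDerivAt_log_one_sub_mul_rpow ha0 ha1 hz0 hz1
      (by positivity : 0 ≤ q + t)).const_mul (t / (q + t))
    have h := ((h1.add h2).sub h3).sub_const ((q / (q + t) - q / (p + t)) * Real.log (1 - a))
    refine h.congr_deriv ?_
    have hpt : p + t ≠ 0 := by positivity
    have hqt : q + t ≠ 0 := by positivity
    generalize z ^ t / (1 - a * z ^ t) = A
    generalize z ^ (p + t) / (1 - a * z ^ (p + t)) = B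
    generalize z ^ (q + t) / (1 - a * z ^ (q + t)) = C
    have hz := hz0.ne'
    field_simp
    ring
  · intro z hz0 hz1
    have e1 := one_sub_mul_rpow_pos ha0 ha1 hz0 hz1 ht.le
    have e2 := one_sub_mul_rpow_pos ha0 ha1 hz0 hz1 (by positivity : 0 ≤ p + t)
    have e3 := one_sub_mul_rpow_pos ha0 ha1 hz0 hz1 (by positivity : 0 ≤ q + t)
    have hθ0 : 0 ≤ q / p := by positivity
    have hθ1 : 0 ≤ 1 - q / p := sub_nonneg.2 ((div_le_one hp).2 hqp)
    have t1 := div_one_sub_mul_tangent ha0 e1 e3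
    have t2 := div_one_sub_mul_tangent ha0 e2 e3
    have hgm := Real.geom_mean_le_arith_mean2_weighted hθ1 hθ0
      (Real.rpow_nonneg hz0.le t) (Real.rpow_nonneg hz0.le (p + t)) (by ring)
    rw [← Real.rpow_mul hz0.le, ← Real.rpow_mul hz0.le, ← Real.rpow_add hz0,
      show t * (1 - q / p) + (p + t) * (q / p) = q + t by field_simp; ring] at hgm
    have hk := mul_nonneg (sub_nonneg.2 hgm) (inv_nonneg.2 (sq_nonneg (1 - a * z ^ (q + t))))
    have s1 := mul_le_mul_of_nonneg_left t1 hθ1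
    have s2 := mul_le_mul_of_nonneg_left t2 hθ0
    have : 0 ≤ (1 - q / p) * (z ^ t / (1 - a * z ^ t))
        + q / p * (z ^ (p + t) / (1 - a * z ^ (p + t))) - z ^ (q + t) / (1 - a * z ^ (q + t)) := by
      simp only [div_eq_mul_inv (_ - _) ((1 - a * z ^ (q + t)) ^ 2)] at s1 s2
      linarith
    have : 0 ≤ a * t / z := by positivity
    nlinarith
  · simp only [Real.one_rpow]
    have hpt : p + t ≠ 0 := by positivity
    have hqt : q + t ≠ 0 := by positivity
    field_simp
    ring

lemma log_one_sub_mul_rpow_combination_zero {a y p t : ℝ} (ha0 : 0 ≤ a) (ha1 : a < 1)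
    (hy0 : 0 < y) (hy1 : y ≤ 1) (hp : 0 < p) (ht : 0 < t) :
    0 ≤ (1 / t - 1 / p) * Real.log (1 - a * y ^ t)
      + 1 / p * (t / (p + t)) * Real.log (1 - a * y ^ (p + t))
      + a * (y ^ t / (1 - a * y ^ t) * Real.log y)
      - (1 / t - 1 / (p + t)) * Real.log (1 - a) := by
  refine nonneg_of_hasDerivAt_nonpos
    (D := fun y => (1 / t - 1 / p) * Real.log (1 - a * y ^ t)
      + 1 / p * (t / (p + t)) * Real.log (1 - a * y ^ (p + t))
      + a * (y ^ t / (1 - a * y ^ t) * Real.log y)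
      - (1 / t - 1 / (p + t)) * Real.log (1 - a))
    (D' := fun y => -(a * t / (p * y)) * (y ^ (p + t) / (1 - a * y ^ (p + t))
      - y ^ t / (1 - a * y ^ t) - y ^ t * (p * Real.log y) / (1 - a * y ^ t) ^ 2))
    hy0 hy1 ?_ ?_ ?_
  · intro z hz0 hz1
    have e1 := one_sub_mul_rpow_pos ha0 ha1 hz0 hz1 ht.le
    have h1 := (hasDerivAt_log_one_sub_mul_rpow ha0 ha1 hz0 hz1 ht.le).const_mul (1 / t - 1 / p)
    have h2 := (hasDerivAt_log_one_sub_mul_rpow ha0 ha1 hz0 hz1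
      (by positivity : 0 ≤ p + t)).const_mul (1 / p * (t / (p + t)))
    have hr := Real.hasDerivAt_rpow_const (p := t) (Or.inl hz0.ne')
    have h3 := ((hr.div ((hr.const_mul a).const_sub 1) e1.ne').mul
      (Real.hasDerivAt_log hz0.ne')).const_mul a
    have h := ((h1.add h2).add h3).sub_const ((1 / t - 1 / (p + t)) * Real.log (1 - a))
    refine h.congr_deriv ?_
    have hpt : p + t ≠ 0 := by positivity
    have e1' := e1.ne'
    simp only [Pi.div_apply]
    rw [Real.rpow_sub_one hz0.ne']
    generalize z ^ (p + t) / (1 - a * z ^ (p + t)) = B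
    generalize Real.log z = l
    generalize z ^ t = w at *
    field_simp
    ring
  · intro z hz0 hz1
    have e1 := one_sub_mul_rpow_pos ha0 ha1 hz0 hz1 ht.le
    have e2 := one_sub_mul_rpow_pos ha0 ha1 hz0 hz1 (by positivity : 0 ≤ p + t)
    have t1 := div_one_sub_mul_tangent ha0 e2 e1
    have hlog := Real.log_le_sub_one_of_pos (Real.rpow_pos_of_pos hz0 p)
    rw [Real.log_rpow hz0] at hlog
    have : z ^ t * (p * Real.log z) / (1 - a * z ^ t) ^ 2
        ≤ (z ^ (p + t) - z ^ t) / (1 - a * z ^ t) ^ 2 := by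
      gcongr
      rw [Real.rpow_add hz0]
      have := mul_le_mul_of_nonneg_left hlog (Real.rpow_nonneg hz0.le t)
      linarith
    have h2 : 0 ≤ a * t / (p * z) := by positivity
    nlinarith
  · simp only [Real.one_rpow, Real.log_one]
    have hpt : p + t ≠ 0 := by positivity
    field_simp
    ring

lemma rpow_mul_rpow_add_le {α β A₁ A₂ B₁ B₂ : ℝ} (hα : 0 < α) (hβ : 0 < β) (hαβ : α + β = 1)
    (hA₁ : 0 ≤ A₁) (hA₂ : 0 ≤ A₂) (hB₁ : 0 ≤ B₁) (hB₂ : 0 ≤ B₂) :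
    A₁ ^ α * B₁ ^ β + A₂ ^ α * B₂ ^ β ≤ (A₁ + A₂) ^ α * (B₁ + B₂) ^ β := by
  have hc : (1 / α).HolderConjugate (1 / β) :=
    Real.holderConjugate_iff.2 ⟨by rw [lt_div_iff₀ hα]; linarith, by simpa using hαβ⟩
  have h := Real.inner_le_Lp_mul_Lq_of_nonneg (Finset.univ : Finset (Fin 2))
    (f := ![A₁ ^ α, A₂ ^ α]) (g := ![B₁ ^ β, B₂ ^ β]) hc
    (by intro i _; fin_cases i <;> simp <;> positivity)
    (by intro i _; fin_cases i <;> simp <;> positivity)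
  simpa [Fin.sum_univ_two, ← Real.rpow_mul, hα.ne', hβ.ne', *] using h

/-- After shrinking `x₁` by a suitable factor `b ≤ 1`, the weighted `(p + t)`-mean dominates a
`p`-mean with other weights, whose `q`-mean at `(b * r₁, r₂)` is still at least `1`. -/
lemma exists_powMean_le_of_pos {lam p q t r₁ r₂ : ℝ} (hl0 : 0 < lam) (hl1 : lam < 1)
    (hq : 0 ≤ q) (hqp : q ≤ p) (hp : 0 < p) (ht : 0 < t) (hr₁ : 0 < r₁) (hr₂ : 0 < r₂)
    (hr₂1 : r₂ ≤ 1) (hN : lam * r₁ ^ (q + t) + (1 - lam) * r₂ ^ (q + t) = 1) :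
    ∃ lam' ∈ Set.Icc (0 : ℝ) 1, ∃ b, 0 < b ∧ b ≤ 1 ∧
      (∀ x₁ x₂, 0 ≤ x₁ → 0 ≤ x₂ →
        powMean p lam' (b * x₁) x₂ ≤ powMean (p + t) lam x₁ x₂) ∧
      1 ≤ powMean q lam' (b * r₁) r₂ := by
  have hP : 0 < p + t := by positivity
  have hQ : 0 < q + t := by positivity
  obtain ⟨a, ha⟩ : ∃ a, a = 1 - lam := ⟨_, rfl⟩
  have hlam : lam = 1 - a := by linarith
  have ha0 : 0 < a := by linarith
  have ha1 : a < 1 := by linarith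
  rw [← ha] at hN
  have et := one_sub_mul_rpow_pos ha0.le ha1 hr₂ hr₂1 ht.le
  have eP := one_sub_mul_rpow_pos ha0.le ha1 hr₂ hr₂1 hP.le
  have eQ := one_sub_mul_rpow_pos ha0.le ha1 hr₂ hr₂1 hQ.le
  obtain ⟨w, hw⟩ : ∃ w, w = (1 - a * r₂ ^ (p + t)) ^ (t / (p + t)) * lam ^ (p / (p + t)) :=
    ⟨_, rfl⟩
  have hw0 : 0 < w := by rw [hw]; positivity
  have hαβ : t / (p + t) + p / (p + t) = 1 := by field_simp; ring
  have holder : ∀ x₁ x₂, 0 ≤ x₁ → 0 ≤ x₂ → w * x₁ ^ p + a * r₂ ^ t * x₂ ^ p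
      ≤ (lam * x₁ ^ (p + t) + a * x₂ ^ (p + t)) ^ (p / (p + t)) := by
    intro x₁ x₂ hx₁ hx₂
    have h := rpow_mul_rpow_add_le (div_pos ht hP) (div_pos hp hP) hαβ eP.le
      (by positivity : 0 ≤ a * r₂ ^ (p + t)) (by positivity : 0 ≤ lam * x₁ ^ (p + t))
      (by positivity : 0 ≤ a * x₂ ^ (p + t))
    rw [sub_add_cancel, Real.one_rpow, one_mul] at h
    convert h using 2
    · rw [hw, Real.mul_rpow hl0.le (by positivity), ← Real.rpow_mul hx₁,
        mul_div_cancel₀ _ hP.ne']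
      ring
    · rw [Real.mul_rpow ha0.le (by positivity), Real.mul_rpow ha0.le (by positivity),
        ← Real.rpow_mul hx₂, ← Real.rpow_mul hr₂.le,
        mul_div_cancel₀ _ hP.ne', mul_div_cancel₀ _ hP.ne']
      have : a ^ (t / (p + t)) * a ^ (p / (p + t)) = a := by
        rw [← Real.rpow_add ha0, hαβ, Real.rpow_one]
      linear_combination (-(r₂ ^ t * x₂ ^ p)) * this
  have hw1 : w ≤ 1 - a * r₂ ^ t := by
    have h := holder 1 1 zero_le_one zero_le_one
    simp only [Real.one_rpow, mul_one] at h
    rw [show lam + a = 1 by linarith, Real.one_rpow] at h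
    linarith
  have hbp : ((w / (1 - a * r₂ ^ t)) ^ (1 / p)) ^ p = w / (1 - a * r₂ ^ t) := by
    rw [← Real.rpow_mul (by positivity), one_div_mul_cancel hp.ne', Real.rpow_one]
  have hb0 : 0 < (w / (1 - a * r₂ ^ t)) ^ (1 / p) := by positivity
  have hlogw : Real.log w = t / (p + t) * Real.log (1 - a * r₂ ^ (p + t))
      + p / (p + t) * Real.log lam := by
    rw [hw, Real.log_mul (by positivity) (by positivity), Real.log_rpow eP, Real.log_rpow hl0]
  have hlogb : Real.log ((w / (1 - a * r₂ ^ t)) ^ (1 / p))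
      = 1 / p * (t / (p + t) * Real.log (1 - a * r₂ ^ (p + t)) + p / (p + t) * Real.log lam
        - Real.log (1 - a * r₂ ^ t)) := by
    rw [Real.log_rpow (by positivity), Real.log_div hw0.ne' et.ne', hlogw]
  have hlogr : (q + t) * Real.log r₁ = Real.log (1 - a * r₂ ^ (q + t)) - Real.log lam := by
    rw [← Real.log_rpow hr₁, ← Real.log_div eQ.ne' hl0.ne']
    congr 1
    rw [eq_div_iff hl0.ne']
    linarith
  refine ⟨1 - a * r₂ ^ t, ⟨et.le, by simp only [sub_le_self_iff]; positivity⟩,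
    (w / (1 - a * r₂ ^ t)) ^ (1 / p), hb0,
    Real.rpow_le_one (by positivity) ((div_le_one et).2 hw1) (by positivity), ?_, ?_⟩
  · intro x₁ x₂ hx₁ hx₂
    rw [powMean, powMean, if_neg hp.ne', if_neg hP.ne', ← ha]
    have h := Real.rpow_le_rpow (by positivity) (holder x₁ x₂ hx₁ hx₂)
      (by positivity : 0 ≤ 1 / p)
    rw [← Real.rpow_mul (by positivity), show p / (p + t) * (1 / p) = 1 / (p + t) by field_simp]
      at h
    rw [Real.mul_rpow hb0.le hx₁, hbp, ← mul_assoc, mul_div_cancel₀ _ et.ne', sub_sub_cancel]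
    exact h
  · generalize (w / (1 - a * r₂ ^ t)) ^ (1 / p) = b at hb0 hlogb
    rcases hq.eq_or_lt with rfl | hq
    · rw [powMean, if_pos rfl, ← Real.log_nonneg_iff (by positivity),
        Real.log_mul (by positivity) (by positivity), Real.log_rpow (by positivity),
        Real.log_rpow hr₂, Real.log_mul hb0.ne' hr₁.ne', hlogb]
      rw [zero_add] at hlogr
      rw [show Real.log r₁ = 1 / t * (Real.log (1 - a * r₂ ^ t) - Real.log lam) by
        rw [← hlogr]; field_simp]
      have h := mul_nonneg et.le
        (log_one_sub_mul_rpow_combination_zero ha0.le ha1 hr₂ hr₂1 hp ht)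
      rw [← hlam] at h
      have e : (1 - a * r₂ ^ t) * (a * (r₂ ^ t / (1 - a * r₂ ^ t) * Real.log r₂))
          = a * r₂ ^ t * Real.log r₂ := by
        have := et.ne'
        rw [mul_comm, mul_assoc, mul_right_comm, div_mul_cancel₀ _ this]
        ring
      have e' : 1 / p * (p / (p + t)) = 1 / (p + t) := by field_simp
      refine h.trans_eq ?_
      linear_combination e - (1 - a * r₂ ^ t) * Real.log lam * e'
    · rw [powMean, if_neg hq.ne']
      refine Real.one_le_rpow ?_ (by positivity)
      have key : lam * r₁ ^ t ≤ (1 - a * r₂ ^ t) * b ^ q := by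
        rw [← Real.log_le_log_iff (by positivity) (by positivity),
          Real.log_mul hl0.ne' (by positivity), Real.log_mul et.ne' (by positivity),
          Real.log_rpow hr₁, Real.log_rpow hb0, hlogb]
        have h := log_one_sub_mul_rpow_combination ha0.le ha1 hr₂ hr₂1 hq hqp ht
        rw [← hlam] at h
        rw [show Real.log r₁ = 1 / (q + t) * (Real.log (1 - a * r₂ ^ (q + t)) - Real.log lam) by
          rw [← hlogr]; field_simp]
        rw [← sub_nonneg]
        refine h.trans_eq ?_
        field_simp
        ring
      rw [Real.mul_rpow hb0.le hr₁.le, sub_sub_cancel]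
      rw [add_comm q t, Real.rpow_add hr₁, Real.rpow_add hr₂] at hN
      have := mul_le_mul_of_nonneg_right key (Real.rpow_nonneg hr₁.le q)
      linarith

lemma exists_powMean_zero_le {lam t r₁ r₂ : ℝ} (hl0 : 0 < lam) (hl1 : lam < 1)
    (ht : 0 < t) (hr₁ : 0 < r₁) (hr₂ : 0 < r₂)
    (hN : lam * r₁ ^ t + (1 - lam) * r₂ ^ t = 1) :
    ∃ lam' ∈ Set.Icc (0 : ℝ) 1, ∃ b, 0 < b ∧ b ≤ 1 ∧
      (∀ x₁ x₂, 0 ≤ x₁ → 0 ≤ x₂ →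
        powMean 0 lam' (b * x₁) x₂ ≤ powMean t lam x₁ x₂) ∧
      1 ≤ powMean 0 lam' (b * r₁) r₂ := by
  have ha0 : 0 < 1 - lam := by linarith
  obtain ⟨c, hc⟩ : ∃ c, c = lam * r₁ ^ t := ⟨_, rfl⟩
  have hc0 : 0 < c := by rw [hc]; positivity
  have hc1 : 0 < 1 - c := by rw [hc, ← hN]; simp only [add_sub_cancel_left]; positivity
  have hc' : 1 - c = (1 - lam) * r₂ ^ t := by linarith
  obtain ⟨b, hb⟩ : ∃ b, b = (r₁ ^ c * r₂ ^ (1 - c))⁻¹ ^ (1 / c) := ⟨_, rfl⟩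
  have hb0 : 0 < b := by rw [hb]; positivity
  have hbc : b ^ c = (r₁ ^ c * r₂ ^ (1 - c))⁻¹ := by
    rw [hb, ← Real.rpow_mul (by positivity), one_div_mul_cancel hc0.ne', Real.rpow_one]
  have hmean : ∀ x₁ x₂, 0 ≤ x₁ → 0 ≤ x₂ →
      powMean 0 c (b * x₁) x₂ ≤ powMean t lam x₁ x₂ := by
    intro x₁ x₂ hx₁ hx₂
    rw [powMean, powMean, if_pos rfl, if_neg ht.ne', Real.mul_rpow hb0.le hx₁, hbc]
    have h := Real.geom_mean_le_arith_mean2_weighted hc0.le hc1.le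
      (by positivity : 0 ≤ (x₁ / r₁) ^ t) (by positivity : 0 ≤ (x₂ / r₂) ^ t) (by ring)
    have e : c * (x₁ / r₁) ^ t + (1 - c) * (x₂ / r₂) ^ t = lam * x₁ ^ t + (1 - lam) * x₂ ^ t := by
      rw [hc', hc, Real.div_rpow hx₁ hr₁.le, Real.div_rpow hx₂ hr₂.le]
      field_simp
    have e' : ((x₁ / r₁) ^ t) ^ c * ((x₂ / r₂) ^ t) ^ (1 - c)
        = ((r₁ ^ c * r₂ ^ (1 - c))⁻¹ * x₁ ^ c * x₂ ^ (1 - c)) ^ t := by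
      rw [← Real.rpow_mul (by positivity), ← Real.rpow_mul (by positivity), mul_comm t c,
        mul_comm t (1 - c), Real.rpow_mul (by positivity), Real.rpow_mul (by positivity),
        ← Real.mul_rpow (by positivity) (by positivity), Real.div_rpow hx₁ hr₁.le,
        Real.div_rpow hx₂ hr₂.le]
      congr 1
      field_simp
    rw [e, e'] at h
    have h' := Real.rpow_le_rpow (by positivity) h (by positivity : 0 ≤ 1 / t)
    rwa [← Real.rpow_mul (by positivity), mul_one_div_cancel ht.ne', Real.rpow_one] at h'
  refine ⟨c, ⟨hc0.le, by linarith⟩, b, hb0, ?_, hmean, ?_⟩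
  · have h := hmean 1 1 zero_le_one zero_le_one
    rw [powMean, powMean, if_pos rfl, if_neg ht.ne'] at h
    simp only [mul_one, Real.one_rpow, add_sub_cancel] at h
    by_contra hb1
    exact absurd h (not_le.2 (Real.one_lt_rpow (not_le.1 hb1) hc0))
  · rw [powMean, if_pos rfl, Real.mul_rpow hb0.le hr₁.le, hbc, mul_assoc, inv_mul_cancel₀]
    positivity

lemma exists_powMean_le {lam p q t r₁ r₂ : ℝ} (hl0 : 0 < lam) (hl1 : lam < 1)
    (hq : 0 ≤ q) (hqp : q ≤ p) (ht : 0 < t) (hr₁ : 0 < r₁) (hr₂ : 0 < r₂)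
    (hr₂1 : r₂ ≤ 1) (hN : lam * r₁ ^ (q + t) + (1 - lam) * r₂ ^ (q + t) = 1) :
    ∃ lam' ∈ Set.Icc (0 : ℝ) 1, ∃ b, 0 < b ∧ b ≤ 1 ∧
      (∀ x₁ x₂, 0 ≤ x₁ → 0 ≤ x₂ →
        powMean p lam' (b * x₁) x₂ ≤ powMean (p + t) lam x₁ x₂) ∧
      1 ≤ powMean q lam' (b * r₁) r₂ := by
  rcases (hq.trans hqp).eq_or_lt with rfl | hp
  · obtain rfl : q = 0 := le_antisymm hqp hq
    simp only [zero_add] at hN ⊢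
    exact exists_powMean_zero_le hl0 hl1 ht hr₁ hr₂ hN
  · exact exists_powMean_le_of_pos hl0 hl1 hq hqp hp ht hr₁ hr₂ hr₂1 hN

lemma powMean_nonneg {p lam x y : ℝ} (hlam : lam ∈ Set.Icc (0 : ℝ) 1) (hx : 0 ≤ x) (hy : 0 ≤ y) :
    0 ≤ powMean p lam x y := by
  have h0 := hlam.1
  have h1 : 0 ≤ 1 - lam := sub_nonneg.2 hlam.2
  rw [powMean]
  split_ifs <;> positivity

lemma powMean_mul {p lam c x y : ℝ} (hlam : lam ∈ Set.Icc (0 : ℝ) 1) (hc : 0 < c) (hx : 0 ≤ x)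
    (hy : 0 ≤ y) : powMean p lam (c * x) (c * y) = c * powMean p lam x y := by
  have h0 := hlam.1
  have h1 : 0 ≤ 1 - lam := sub_nonneg.2 hlam.2
  rw [powMean, powMean]
  split_ifs with hp
  · rw [Real.mul_rpow hc.le hx, Real.mul_rpow hc.le hy, mul_mul_mul_comm, ← Real.rpow_add hc,
      add_sub_cancel, Real.rpow_one]
  · rw [Real.mul_rpow hc.le hx, Real.mul_rpow hc.le hy, mul_left_comm, mul_left_comm (1 - lam),
      ← mul_add, Real.mul_rpow (by positivity) (by positivity), ← Real.rpow_mul hc.le,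
      mul_one_div_cancel hp, Real.rpow_one]

lemma mem_lpComb {n : ℕ} {p lam : ℝ} {K L : Set (Euc n)} {x : Euc n} :
    x ∈ lpComb p lam K L ↔
      ∀ u : Euc n, ‖u‖ = 1 → ⟪x, u⟫ ≤ powMean p lam (suppFn K u) (suppFn L u) := by
  unfold lpComb powMean
  split_ifs <;> rfl

lemma lpComb_comm {n : ℕ} (p lam : ℝ) (K L : Set (Euc n)) :
    lpComb p (1 - lam) L K = lpComb p lam K L := by
  ext x
  simp only [mem_lpComb, powMean, sub_sub_cancel, mul_comm (suppFn L _ ^ (1 - lam)),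
    add_comm ((1 - lam) * _)]

lemma PQIneq.symm {n : ℕ} {μ : Measure (Euc n)} {p q : ℝ} {K L : Set (Euc n)}
    (h : PQIneq μ p q K L) : PQIneq μ p q L K := by
  intro lam hlam
  have h' := h (1 - lam) ⟨sub_nonneg.2 hlam.2, by linarith [hlam.1]⟩
  rwa [lpComb_comm, sub_sub_cancel, mul_comm, add_comm] at h'

section Pointwise

open scoped Pointwise

lemma suppFn_smul {n : ℕ} {b : ℝ} (hb : 0 ≤ b) (K : Set (Euc n)) (u : Euc n) :
    suppFn (b • K) u = b * suppFn K u := by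
  rw [suppFn, suppFn, ← smul_eq_mul, ← Real.sSup_smul_of_nonneg hb]
  congr 1
  ext s
  simp [Set.mem_smul_set, inner_smul_right]

lemma IsConvexBody.inner_le_suppFn {n : ℕ} {K : Set (Euc n)} (hK : IsConvexBody K) {y : Euc n}
    (hy : y ∈ K) (u : Euc n) : ⟪u, y⟫ ≤ suppFn K u :=
  le_csSup (hK.1.image (by fun_prop)).bddAbove ⟨y, hy, rfl⟩

lemma IsConvexBody.zero_mem {n : ℕ} {K : Set (Euc n)} (hK : IsConvexBody K) (hs : K = -K) :
    (0 : Euc n) ∈ K := by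
  obtain ⟨x, hx⟩ := hK.2.2
  have hx := interior_subset hx
  have hx' : -x ∈ K := by rw [hs]; simpa using hx
  simpa using hK.2.1.midpoint_mem hx hx'

lemma IsConvexBody.suppFn_nonneg {n : ℕ} {K : Set (Euc n)} (hK : IsConvexBody K) (hs : K = -K)
    (u : Euc n) : 0 ≤ suppFn K u := by
  simpa using hK.inner_le_suppFn (hK.zero_mem hs) u

lemma IsConvexBody.smul {n : ℕ} {K : Set (Euc n)} (hK : IsConvexBody K) {b : ℝ} (hb : b ≠ 0) :
    IsConvexBody (b • K) := by
  refine ⟨hK.1.smul b, hK.2.1.smul b, ?_⟩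
  rw [interior_smul₀ hb]
  exact hK.2.2.smul_set

/-- `lpComb` with `p > 0` contains the dilate of each of its constituents by its weight. -/
lemma smul_subset_lpComb {n : ℕ} {p lam : ℝ} {K L : Set (Euc n)} (hp : 0 < p)
    (hlam : lam ∈ Set.Icc (0 : ℝ) 1) (hK : IsConvexBody K) (hL : IsConvexBody L) (hKs : K = -K)
    (hLs : L = -L) : lam ^ (1 / p) • K ⊆ lpComb p lam K L := by
  rintro _ ⟨y, hy, rfl⟩
  rw [mem_lpComb]
  intro u _
  have h1 := hK.inner_le_suppFn hy u
  have hk := hK.suppFn_nonneg hKs u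
  have hl := hL.suppFn_nonneg hLs u
  have hlam0 := hlam.1
  have hlam1 : 0 ≤ 1 - lam := sub_nonneg.2 hlam.2
  rw [powMean, if_neg hp.ne']
  calc ⟪lam ^ (1 / p) • y, u⟫ = lam ^ (1 / p) * ⟪u, y⟫ := by
        rw [real_inner_smul_left, real_inner_comm]
    _ ≤ lam ^ (1 / p) * suppFn K u := by gcongr
    _ = (lam * suppFn K u ^ p) ^ (1 / p) := by
        rw [Real.mul_rpow hlam0 (by positivity), ← Real.rpow_mul hk, mul_one_div_cancel hp.ne',
          Real.rpow_one]
    _ ≤ _ := by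
        gcongr
        exact le_add_of_nonneg_right (by positivity)

lemma le_apply_smul_of_even_of_logConcave {n : ℕ} {f : Euc n → ℝ} (hf0 : ∀ x, 0 ≤ f x)
    (hfeven : ∀ x, f (-x) = f x)
    (hf : ∀ x y : Euc n, ∀ lam ∈ Set.Icc (0:ℝ) 1,
      f x ^ lam * f y ^ (1 - lam) ≤ f (lam • x + (1 - lam) • y))
    {b : ℝ} (hb0 : 0 ≤ b) (hb1 : b ≤ 1) (x : Euc n) : f x ≤ f (b • x) := by
  have h := hf x (-x) ((1 + b) / 2) ⟨by linarith, by linarith⟩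
  rw [hfeven] at h
  have e : ((1 + b) / 2) • x + (1 - (1 + b) / 2) • -x = b • x := by module
  rw [e] at h
  rcases (hf0 x).eq_or_lt with h0 | h0
  · rw [← h0]; exact hf0 _
  · rwa [← Real.rpow_add h0, add_sub_cancel, Real.rpow_one] at h

lemma ofReal_pow_mul_le_smul {n : ℕ} {f : Euc n → ℝ} {b : ℝ} (hb : 0 < b)
    (hf : ∀ x, f x ≤ f (b • x)) {K : Set (Euc n)} (hK : IsCompact K) :
    ENNReal.ofReal (b ^ n) * volume.withDensity (fun x => ENNReal.ofReal (f x)) K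
      ≤ volume.withDensity (fun x => ENNReal.ofReal (f x)) (b • K) := by
  have hbK := (hK.smul b).measurableSet
  rw [withDensity_apply _ hK.measurableSet, withDensity_apply _ hbK,
    ← lintegral_indicator hK.measurableSet, ← lintegral_indicator hbK]
  have hmap := Measure.map_addHaar_smul (volume : Measure (Euc n)) hb.ne'
  have hvol : (volume : Measure (Euc n))
      = ENNReal.ofReal (b ^ n) • Measure.map (b • ·) volume := by
    rw [hmap, smul_smul, ← ENNReal.ofReal_mul (by positivity), finrank_euclideanSpace_fin,
      abs_of_pos (by positivity), mul_inv_cancel₀ (by positivity), ENNReal.ofReal_one, one_smul]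
  conv_rhs => rw [hvol]
  rw [lintegral_smul_measure, smul_eq_mul]
  gcongr ENNReal.ofReal (b ^ n) * ?_
  have hemb : MeasurableEmbedding fun x : Euc n => b • x :=
    (Homeomorph.smulOfNeZero b hb.ne').measurableEmbedding
  rw [hemb.lintegral_map]
  refine lintegral_mono fun x => ?_
  by_cases hx : x ∈ K
  · rw [Set.indicator_of_mem hx, Set.indicator_of_mem (Set.smul_mem_smul_set hx)]
    exact ENNReal.ofReal_le_ofReal (hf x)
  · rw [Set.indicator_of_notMem hx]
    exact zero_le

lemma withDensity_lt_top_of_isCompact {n : ℕ} {f : Euc n → ℝ} {C : ℝ} (hf : ∀ x, f x ≤ C)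
    {K : Set (Euc n)} (hK : IsCompact K) :
    volume.withDensity (fun x => ENNReal.ofReal (f x)) K < ⊤ := by
  rw [withDensity_apply _ hK.measurableSet]
  calc ∫⁻ x in K, ENNReal.ofReal (f x) ≤ ∫⁻ _ in K, ENNReal.ofReal C :=
        lintegral_mono fun x => ENNReal.ofReal_le_ofReal (hf x)
    _ = ENNReal.ofReal C * volume K := by rw [setLIntegral_const]
    _ < ⊤ := ENNReal.mul_lt_top ENNReal.ofReal_lt_top hK.measure_lt_top

lemma ofReal_pow_rpow_div {n : ℕ} (hn : n ≠ 0) {x : ℝ} (hx : 0 ≤ x) {q : ℝ} (hq : 0 ≤ q) :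
    ENNReal.ofReal (x ^ n) ^ (q / (n : ℝ)) = ENNReal.ofReal (x ^ q) := by
  have : (n : ℝ) ≠ 0 := by exact_mod_cast hn
  rw [ENNReal.ofReal_rpow_of_nonneg (by positivity) (by positivity), ← Real.rpow_natCast,
    ← Real.rpow_mul hx, mul_div_cancel₀ _ this]

/-- The two cases of `PQIneq` in terms of `n`-th roots. -/
lemma PQIneq.ofReal_powMean_pow_le {n : ℕ} (hn : n ≠ 0) {μ : Measure (Euc n)} {p q lam x y : ℝ}
    {K L : Set (Euc n)} (h : PQIneq μ p q K L) (hq : 0 ≤ q) (hlam : lam ∈ Set.Icc (0 : ℝ) 1)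
    (hx : 0 ≤ x) (hy : 0 ≤ y) (hxK : ENNReal.ofReal (x ^ n) ≤ μ K)
    (hyL : ENNReal.ofReal (y ^ n) ≤ μ L) :
    ENNReal.ofReal (powMean q lam x y ^ n) ≤ μ (lpComb p lam K L) := by
  have hn' : (0 : ℝ) < n := by exact_mod_cast Nat.pos_of_ne_zero hn
  have hlam0 := hlam.1
  have hlam1 : 0 ≤ 1 - lam := sub_nonneg.2 hlam.2
  rw [powMean]
  split_ifs with hq0
  · refine le_trans ?_ ((h lam hlam).1 hq0)
    calc ENNReal.ofReal ((x ^ lam * y ^ (1 - lam)) ^ n)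
        = ENNReal.ofReal (x ^ n) ^ lam * ENNReal.ofReal (y ^ n) ^ (1 - lam) := by
          rw [ENNReal.ofReal_rpow_of_nonneg (by positivity) hlam0,
            ENNReal.ofReal_rpow_of_nonneg (by positivity) hlam1,
            ← ENNReal.ofReal_mul (by positivity), mul_pow]
          simp only [← Real.rpow_natCast, ← Real.rpow_mul hx, ← Real.rpow_mul hy, mul_comm]
      _ ≤ _ := by gcongr
  · have hq' : 0 < q := lt_of_le_of_ne hq (Ne.symm hq0)
    rw [← ENNReal.rpow_le_rpow_iff (div_pos hq' hn')]
    refine le_trans ?_ ((h lam hlam).2 hq0)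
    calc ENNReal.ofReal (((lam * x ^ q + (1 - lam) * y ^ q) ^ (1 / q)) ^ n) ^ (q / (n : ℝ))
        = ENNReal.ofReal lam * ENNReal.ofReal (x ^ n) ^ (q / (n : ℝ))
          + ENNReal.ofReal (1 - lam) * ENNReal.ofReal (y ^ n) ^ (q / (n : ℝ)) := by
          rw [ofReal_pow_rpow_div hn (by positivity) hq, ofReal_pow_rpow_div hn hx hq,
            ofReal_pow_rpow_div hn hy hq, ← Real.rpow_mul (by positivity),
            one_div_mul_cancel hq0, Real.rpow_one, ENNReal.ofReal_add (by positivity)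
            (by positivity), ENNReal.ofReal_mul hlam0, ENNReal.ofReal_mul hlam1]
      _ ≤ _ := by gcongr

lemma ofReal_mul_rpow_le_lpComb {n : ℕ} (hn : n ≠ 0) {μ : Measure (Euc n)} {p q lam : ℝ}
    (hscale : ∀ b, 0 < b → b ≤ 1 → ∀ K : Set (Euc n), IsCompact K →
      ENNReal.ofReal (b ^ n) * μ K ≤ μ (b • K))
    (hq : 0 < q) (hqp : q ≤ p) {K L : Set (Euc n)}
    (hlam : lam ∈ Set.Icc (0 : ℝ) 1) (hK : IsConvexBody K) (hL : IsConvexBody L) (hKs : K = -K)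
    (hLs : L = -L) :
    ENNReal.ofReal lam * μ K ^ (q / (n : ℝ)) ≤ μ (lpComb p lam K L) ^ (q / (n : ℝ)) := by
  have hp : 0 < p := hq.trans_le hqp
  rcases hlam.1.eq_or_lt with rfl | hlam0
  · simp
  have hc0 : 0 < lam ^ (1 / p) := by positivity
  have hc1 : lam ^ (1 / p) ≤ 1 := Real.rpow_le_one hlam0.le hlam.2 (by positivity)
  have hle : lam ≤ (lam ^ (1 / p)) ^ q := by
    rw [← Real.rpow_mul hlam0.le]
    refine (Real.rpow_one lam).symm.trans_le
      (Real.rpow_le_rpow_of_exponent_ge hlam0 hlam.2 ?_)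
    rw [one_div_mul_eq_div]
    exact (div_le_one hp).2 hqp
  calc ENNReal.ofReal lam * μ K ^ (q / (n : ℝ))
      ≤ ENNReal.ofReal ((lam ^ (1 / p)) ^ q) * μ K ^ (q / (n : ℝ)) := by gcongr
    _ = (ENNReal.ofReal ((lam ^ (1 / p)) ^ n) * μ K) ^ (q / (n : ℝ)) := by
        rw [ENNReal.mul_rpow_of_nonneg _ _ (by positivity), ofReal_pow_rpow_div hn hc0.le hq.le]
    _ ≤ _ := by
        gcongr
        exact (hscale _ hc0 hc1 K hK.1).trans
          (measure_mono (smul_subset_lpComb hp hlam hK hL hKs hLs))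

lemma pqIneq_add_of_measure_le {n : ℕ} (hn : n ≠ 0) {μ : Measure (Euc n)} {p q t : ℝ}
    (hscale : ∀ b, 0 < b → b ≤ 1 → ∀ K : Set (Euc n), IsCompact K →
      ENNReal.ofReal (b ^ n) * μ K ≤ μ (b • K))
    (hfin : ∀ K : Set (Euc n), IsCompact K → μ K < ⊤)
    (hq : 0 ≤ q) (hqp : q ≤ p) (ht : 0 < t)
    (H : ∀ K L : Set (Euc n), IsConvexBody K → IsConvexBody L → K = -K → L = -L →
      PQIneq μ p q K L)
    {K L : Set (Euc n)} (hK : IsConvexBody K) (hL : IsConvexBody L) (hKs : K = -K) (hLs : L = -L)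
    (hLK : μ L ≤ μ K) : PQIneq μ (p + t) (q + t) K L := by
  have hQ : 0 < q + t := by positivity
  have hn' : (0 : ℝ) < n := by exact_mod_cast Nat.pos_of_ne_zero hn
  have hQP : q + t ≤ p + t := by linarith
  intro lam hlam
  refine ⟨fun h => absurd h hQ.ne', fun _ => ?_⟩
  have hKcase := ofReal_mul_rpow_le_lpComb hn hscale hQ hQP hlam hK hL hKs hLs
  have hLcase := ofReal_mul_rpow_le_lpComb hn hscale hQ hQP
    (lam := 1 - lam) ⟨sub_nonneg.2 hlam.2, by linarith [hlam.1]⟩ hL hK hLs hKs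
  rw [lpComb_comm] at hLcase
  rcases hlam.1.eq_or_lt with rfl | hl0
  · simpa using hLcase
  rcases hlam.2.eq_or_lt with rfl | hl1
  · simpa using hKcase
  rcases eq_or_ne (μ L) 0 with hL0 | hL0
  · rw [hL0, ENNReal.zero_rpow_of_pos (by positivity), mul_zero, add_zero]
    exact hKcase
  have hroot : ∀ A : Set (Euc n), IsCompact A → μ A ≠ 0 →
      ∃ k : ℝ, 0 < k ∧ μ A = ENNReal.ofReal (k ^ n) := by
    intro A hA hA0
    have hpos := ENNReal.toReal_pos hA0 (hfin A hA).ne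
    refine ⟨(μ A).toReal ^ (1 / (n : ℝ)), by positivity, ?_⟩
    rw [← Real.rpow_natCast, ← Real.rpow_mul hpos.le, one_div_mul_cancel hn'.ne', Real.rpow_one,
      ENNReal.ofReal_toReal (hfin A hA).ne]
  obtain ⟨k, hk0, hk⟩ := hroot K hK.1 fun h => hL0 (le_antisymm (h ▸ hLK) zero_le)
  obtain ⟨l, hl0', hl⟩ := hroot L hL.1 hL0
  have hlk : l ≤ k := by
    rw [hk, hl, ENNReal.ofReal_le_ofReal_iff (by positivity)] at hLK
    exact le_of_pow_le_pow_left₀ hn hk0.le hLK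
  have ha0 : 0 < 1 - lam := by linarith
  obtain ⟨N, hN⟩ : ∃ N, N = (lam * k ^ (q + t) + (1 - lam) * l ^ (q + t)) ^ (1 / (q + t)) :=
    ⟨_, rfl⟩
  have hN0 : 0 < N := by rw [hN]; positivity
  have hNQ : N ^ (q + t) = lam * k ^ (q + t) + (1 - lam) * l ^ (q + t) := by
    rw [hN, ← Real.rpow_mul (by positivity), one_div_mul_cancel hQ.ne', Real.rpow_one]
  have hlN : l / N ≤ 1 := by
    rw [div_le_one hN0, ← Real.rpow_le_rpow_iff hl0'.le hN0.le hQ, hNQ]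
    have := Real.rpow_le_rpow hl0'.le hlk hQ.le
    nlinarith
  have hnorm : lam * (k / N) ^ (q + t) + (1 - lam) * (l / N) ^ (q + t) = 1 := by
    rw [Real.div_rpow hk0.le hN0.le, Real.div_rpow hl0'.le hN0.le, mul_div_assoc', mul_div_assoc',
      ← add_div, ← hNQ, div_self (by positivity)]
  obtain ⟨lam', hlam', b, hb0, hb1, hmean, hge⟩ := exists_powMean_le hl0 hl1 hq hqp ht
    (div_pos hk0 hN0) (div_pos hl0' hN0) hlN hnorm
  have hbK : b • K = -(b • K) := by rw [← Set.smul_set_neg, ← hKs]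
  have hmeas : ENNReal.ofReal (N ^ n) ≤ μ (lpComb (p + t) lam K L) := by
    calc ENNReal.ofReal (N ^ n)
        ≤ ENNReal.ofReal (powMean q lam' (b * k) l ^ n) := by
          gcongr
          have e := powMean_mul (p := q) hlam' hN0 (by positivity : 0 ≤ b * (k / N))
            (by positivity : 0 ≤ l / N)
          rw [show N * (b * (k / N)) = b * k by field_simp, mul_div_cancel₀ _ hN0.ne'] at e
          rw [e]
          exact le_mul_of_one_le_right hN0.le hge
      _ ≤ μ (lpComb p lam' (b • K) L) := by
          refine (H (b • K) L (hK.smul hb0.ne') hL hbK hLs).ofReal_powMean_pow_le hn hq hlam'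
            (by positivity) hl0'.le ?_ hl.ge
          rw [mul_pow, ENNReal.ofReal_mul (by positivity), ← hk]
          exact hscale b hb0 hb1 K hK.1
      _ ≤ _ := by
          refine measure_mono fun x hx => ?_
          rw [mem_lpComb] at hx ⊢
          intro u hu
          refine (hx u hu).trans ?_
          rw [suppFn_smul hb0.le]
          exact hmean _ _ (hK.suppFn_nonneg hKs u) (hL.suppFn_nonneg hLs u)
  calc ENNReal.ofReal lam * μ K ^ ((q + t) / (n : ℝ))
        + ENNReal.ofReal (1 - lam) * μ L ^ ((q + t) / (n : ℝ))
      = ENNReal.ofReal (N ^ n) ^ ((q + t) / (n : ℝ)) := by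
        rw [hk, hl, ofReal_pow_rpow_div hn hk0.le hQ.le, ofReal_pow_rpow_div hn hl0'.le hQ.le,
          ofReal_pow_rpow_div hn hN0.le hQ.le, hNQ, ENNReal.ofReal_add (by positivity)
          (by positivity), ENNReal.ofReal_mul hl0.le, ENNReal.ofReal_mul ha0.le]
    _ ≤ _ := by gcongr

end Pointwise

/-- Proposition 1.4: for an even log-concave measure `μ` (given by an even log-concave
density `f`), if `μ` satisfies the `(p,q)`-inequality for all pairs of origin-symmetric
convex bodies, then it satisfies the `(p+t, q+t)`-inequality for all such pairs. -/
theorem pq_implies_pq_shift (n : ℕ) (hn : 1 ≤ n) (f : Euc n → ℝ)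
    (hf0 : ∀ x, 0 ≤ f x) (hfeven : ∀ x, f (-x) = f x)
    (hflogconc : ∀ x y : Euc n, ∀ lam ∈ Set.Icc (0:ℝ) 1,
      f x ^ lam * f y ^ (1 - lam) ≤ f (lam • x + (1 - lam) • y))
    (μ : Measure (Euc n))
    (hμ : μ = volume.withDensity fun x => ENNReal.ofReal (f x))
    (p q t : ℝ) (hq0 : 0 ≤ q) (hqp : q ≤ p) (ht : 0 < t) (hpt : p + t ≤ 1)
    (H : ∀ K L : Set (Euc n), IsConvexBody K → IsConvexBody L → K = -K → L = -L →
      PQIneq μ p q K L) :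
    ∀ K L : Set (Euc n), IsConvexBody K → IsConvexBody L → K = -K → L = -L →
      PQIneq μ (p + t) (q + t) K L := by
  subst hμ
  have hn0 : n ≠ 0 := Nat.one_le_iff_ne_zero.1 hn
  have hray := @le_apply_smul_of_even_of_logConcave n f hf0 hfeven hflogconc
  have hscale := fun b (hb0 : 0 < b) (hb1 : b ≤ 1) (K : Set (Euc n)) (hK : IsCompact K) =>
    ofReal_pow_mul_le_smul hb0 (hray hb0.le hb1) hK
  have hmax : ∀ x, f x ≤ f 0 := fun x => by simpa using hray le_rfl zero_le_one x
  have hfin := fun (K : Set (Euc n)) (hK : IsCompact K) => withDensity_lt_top_of_isCompact hmax hK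
  intro K L hK hL hKs hLs
  rcases le_total (volume.withDensity (fun x => ENNReal.ofReal (f x)) L)
    (volume.withDensity (fun x => ENNReal.ofReal (f x)) K) with h | h
  · exact pqIneq_add_of_measure_le hn0 hscale hfin hq0 hqp ht H hK hL hKs hLs h
  · exact (pqIneq_add_of_measure_le hn0 hscale hfin hq0 hqp ht H hL hK hLs hKs h).symm

end
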